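/- Let n ≥ 1, 1 < p < ∞, 0 < q < p−1, 0 < α < n/p, 0 < r < ∞, and let σ be a locally finite nonnegative Borel measure on ℝⁿ. If K_{α,p,q}σ ∈ L^r(ℝⁿ), then W_{α,p}σ ∈ L^{r(p−1)/(p−1−q)}(ℝⁿ). -/

import Mathlib

open MeasureTheory Metric Set
open scoped ENNReal NNReal

/-- The Wolff potential `W_{α,p}ν(x) = ∫₀^∞ (ν(B(x,ρ))/ρ^{n−αp})^{1/(p−1)} dρ/ρ`. -/
noncomputable def wolffPot (n : ℕ) (α p : ℝ)
    (ν : Measure (EuclideanSpace ℝ (Fin n))) (x : EuclideanSpace ℝ (Fin n)) : ℝ≥0∞ :=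
  ∫⁻ ρ in Set.Ioi (0 : ℝ),
    (ν (Metric.ball x ρ) / ENNReal.ofReal (ρ ^ ((n : ℝ) - α * p))) ^ (1 / (p - 1)) /
      ENNReal.ofReal ρ

/-- The least constant `κ(E)` such that
`(∫_E (W_{α,p}ν)^q dσ)^{1/q} ≤ κ · ν(ℝⁿ)^{1/(p−1)}` for all finite measures `ν`. -/
noncomputable def embC (n : ℕ) (α p q : ℝ) (σ : Measure (EuclideanSpace ℝ (Fin n)))
    (E : Set (EuclideanSpace ℝ (Fin n))) : ℝ≥0∞ :=
  sInf {κ : ℝ≥0∞ | ∀ ν : Measure (EuclideanSpace ℝ (Fin n)), IsFiniteMeasure ν →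
    (∫⁻ y in E, wolffPot n α p ν y ^ q ∂σ) ^ (1 / q) ≤ κ * (ν Set.univ) ^ (1 / (p - 1))}

/-- The intrinsic potential of Wolff type
`K_{α,p,q}σ(x) = ∫₀^∞ (κ(B(x,ρ))^{q(p−1)/(p−1−q)}/ρ^{n−αp})^{1/(p−1)} dρ/ρ`. -/
noncomputable def intK (n : ℕ) (α p q : ℝ) (σ : Measure (EuclideanSpace ℝ (Fin n)))
    (x : EuclideanSpace ℝ (Fin n)) : ℝ≥0∞ :=
  ∫⁻ ρ in Set.Ioi (0 : ℝ),
    (embC n α p q σ (Metric.ball x ρ) ^ (q * (p - 1) / (p - 1 - q)) /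
      ENNReal.ofReal (ρ ^ ((n : ℝ) - α * p))) ^ (1 / (p - 1)) / ENNReal.ofReal ρ

theorem ENNReal.add_pow_succ_le (x y : ℝ≥0∞) (m : ℕ) :
    (x + y) ^ (m + 1) ≤ y ^ (m + 1) + (m + 1) * (x * (x + y) ^ m) := by
  induction m with
  | zero => simp [add_comm]
  | succ m ih =>
    calc (x + y) ^ (m + 1 + 1) = x * (x + y) ^ (m + 1) + y * (x + y) ^ (m + 1) := by ring
      _ ≤ x * (x + y) ^ (m + 1) + y * (y ^ (m + 1) + (m + 1) * (x * (x + y) ^ m)) := by gcongr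
      _ = x * (x + y) ^ (m + 1) + y ^ (m + 1 + 1) + (m + 1) * (x * (y * (x + y) ^ m)) := by ring
      _ ≤ x * (x + y) ^ (m + 1) + y ^ (m + 1 + 1)
          + (m + 1) * (x * ((x + y) * (x + y) ^ m)) := by
        gcongr; exact le_add_self
      _ = _ := by push_cast; ring

theorem ENNReal.sum_Ico_pow_succ_le (f : ℕ → ℝ≥0∞) (N m : ℕ) {k : ℕ} (hk : k ≤ N) :
    (∑ i ∈ Finset.Ico k N, f i) ^ (m + 1)
      ≤ (m + 1) * ∑ j ∈ Finset.Ico k N, f j * (∑ i ∈ Finset.Ico j N, f i) ^ m := by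
  induction hk using Nat.decreasingInduction with
  | self => simp
  | of_succ k hk ih =>
    rw [Finset.sum_eq_sum_Ico_succ_bot hk,
      Finset.sum_eq_sum_Ico_succ_bot hk (fun j => f j * (∑ i ∈ Finset.Ico j N, f i) ^ m), mul_add,
      Finset.sum_eq_sum_Ico_succ_bot hk f, add_comm (_ * _)]
    exact (ENNReal.add_pow_succ_le _ _ _).trans (by gcongr)

theorem ENNReal.sum_range_pow_add_two_le (f : ℕ → ℝ≥0∞) (N m : ℕ) :
    (∑ i ∈ Finset.range N, f i) ^ (m + 2)
      ≤ (m + 2) * (m + 1) * ∑ j ∈ Finset.range N, ∑ k ∈ Finset.range (j + 1),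
        f k * (f j * (∑ i ∈ Finset.Ico j N, f i) ^ m) := by
  have h := ENNReal.sum_Ico_pow_succ_le f N (m + 1) (Nat.zero_le N)
  rw [← Finset.range_eq_Ico] at h
  refine h.trans ?_
  push_cast
  rw [add_assoc, one_add_one_eq_two, mul_assoc]
  gcongr
  calc ∑ k ∈ Finset.range N, f k * (∑ i ∈ Finset.Ico k N, f i) ^ (m + 1)
      ≤ ∑ k ∈ Finset.range N, f k * ((m + 1) *
          ∑ j ∈ Finset.Ico k N, f j * (∑ i ∈ Finset.Ico j N, f i) ^ m) := by
        refine Finset.sum_le_sum fun k hk => ?_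
        gcongr
        exact ENNReal.sum_Ico_pow_succ_le f N m (Finset.mem_range.1 hk).le
    _ = (m + 1) * ∑ k ∈ Finset.range N, ∑ j ∈ Finset.Ico k N,
          f k * (f j * (∑ i ∈ Finset.Ico j N, f i) ^ m) := by
        simp_rw [Finset.mul_sum]
        exact Finset.sum_congr rfl fun k _ => Finset.sum_congr rfl fun j _ => by ring
    _ = _ := by
        congr 1
        refine Finset.sum_comm' fun k j => ?_
        simp only [Finset.mem_range, Finset.mem_Ico]
        omega

theorem ENNReal.mul_mul_add_pow_le_half {C : ℝ≥0∞} (hC : C ≠ ⊤) (hC1 : 1 ≤ C) (F P : ℝ≥0∞)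
    (m : ℕ) :
    C * (P * (F + P) ^ m)
      ≤ 2⁻¹ * F ^ (m + 1) + C * (C * 2 ^ (m + 1) + 1) ^ m * P ^ (m + 1) := by
  have hD0 : C * 2 ^ (m + 1) ≠ 0 := by
    have : C ≠ 0 := (zero_lt_one.trans_le hC1).ne'
    positivity
  have hDt : C * 2 ^ (m + 1) ≠ ⊤ := ENNReal.mul_ne_top hC (by finiteness)
  rcases le_total (C * 2 ^ (m + 1) * P) F with h | h
  · refine le_add_right ?_
    have hPF : P ≤ F := le_trans (le_mul_of_one_le_left zero_le
      (one_le_mul hC1 (one_le_pow₀ one_le_two))) h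
    calc C * (P * (F + P) ^ m) ≤ C * (P * (F + F) ^ m) := by gcongr
      _ = 2⁻¹ * 2 * (C * (P * (2 * F) ^ m)) := by
        rw [ENNReal.inv_mul_cancel (by norm_num) (by norm_num), one_mul, two_mul]
      _ = 2⁻¹ * ((C * 2 ^ (m + 1) * P) * F ^ m) := by rw [mul_pow, pow_succ]; ring
      _ ≤ 2⁻¹ * (F * F ^ m) := by gcongr
      _ = _ := by rw [pow_succ']
  · refine le_add_left ?_
    calc C * (P * (F + P) ^ m) ≤ C * (P * (C * 2 ^ (m + 1) * P + P) ^ m) := by gcongr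
      _ = C * (P * ((C * 2 ^ (m + 1) + 1) * P) ^ m) := by rw [add_mul, one_mul]
      _ = _ := by rw [mul_pow, pow_succ]; ring

theorem MeasureTheory.lintegral_pow_le_of_le_mul_add_pow {X : Type*} [MeasurableSpace X]
    {μ : Measure X} {F P : X → ℝ≥0∞} {m : ℕ} {C : ℝ≥0∞} (hP : Measurable P)
    (hC : C ≠ ⊤) (hC1 : 1 ≤ C)
    (h : ∫⁻ x, F x ^ (m + 1) ∂μ ≤ C * ∫⁻ x, P x * (F x + P x) ^ m ∂μ)
    (hF : ∫⁻ x, F x ^ (m + 1) ∂μ ≠ ⊤) :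
    ∫⁻ x, F x ^ (m + 1) ∂μ ≤ 2 * (C * (C * 2 ^ (m + 1) + 1) ^ m) * ∫⁻ x, P x ^ (m + 1) ∂μ := by
  set A := ∫⁻ x, F x ^ (m + 1) ∂μ
  have h1 : A ≤ 2⁻¹ * A + C * (C * 2 ^ (m + 1) + 1) ^ m * ∫⁻ x, P x ^ (m + 1) ∂μ := by
    refine h.trans ?_
    rw [← lintegral_const_mul' C _ hC, ← lintegral_const_mul' (_ * _) _ (by finiteness),
      ← lintegral_const_mul' 2⁻¹ _ (by simp), ← lintegral_add_right _ (by fun_prop)]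
    exact lintegral_mono fun x => ENNReal.mul_mul_add_pow_le_half hC hC1 _ _ _
  have h2 : 2⁻¹ * A + 2⁻¹ * A ≤
      2⁻¹ * A + C * (C * 2 ^ (m + 1) + 1) ^ m * ∫⁻ x, P x ^ (m + 1) ∂μ := by
    rwa [← add_mul, ENNReal.inv_two_add_inv_two, one_mul]
  have h3 := (ENNReal.add_le_add_iff_left (ENNReal.mul_ne_top (by simp) hF)).1 h2
  calc A = 2 * (2⁻¹ * A) := by
        rw [← mul_assoc, ENNReal.mul_inv_cancel (by norm_num) (by norm_num), one_mul]
    _ ≤ _ := by rw [mul_assoc 2]; gcongr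

theorem MeasureTheory.lintegral_rpow_le_rpow_lintegral_mul {X : Type*} [MeasurableSpace X]
    {μ : Measure X} {f : X → ℝ≥0∞} (hf : Measurable f) {a : ℝ} (ha0 : 0 < a) (ha1 : a ≤ 1) :
    ∫⁻ x, f x ^ a ∂μ ≤ (∫⁻ x, f x ∂μ) ^ a * μ univ ^ (1 - a) := by
  have h := eLpNorm'_le_eLpNorm'_mul_rpow_measure_univ ha0 ha1 (μ := μ) (f := f)
    hf.aestronglyMeasurable
  simp only [eLpNorm', enorm_eq_self, ENNReal.rpow_one, div_one] at h
  have h2 := ENNReal.rpow_le_rpow h ha0.le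
  rwa [← ENNReal.rpow_mul, one_div, inv_mul_cancel₀ ha0.ne', ENNReal.rpow_one,
    ENNReal.mul_rpow_of_nonneg _ _ ha0.le, ← ENNReal.rpow_mul, sub_mul,
    inv_mul_cancel₀ ha0.ne', one_mul] at h2

section Balls

variable {n : ℕ}

local notation "𝔼" => EuclideanSpace ℝ (Fin n)

theorem measurable_measure_ball (σ : Measure 𝔼) [SFinite σ] (r : ℝ) :
    Measurable fun x => σ (ball x r) := by
  have hs : MeasurableSet {z : 𝔼 × 𝔼 | dist z.2 z.1 < r} :=
    (isOpen_lt (by fun_prop) (by fun_prop)).measurableSet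
  exact measurable_measure_prodMk_left hs

theorem setLIntegral_measure_ball_le (σ : Measure 𝔼) [SFinite σ] (y : 𝔼) (R r : ℝ) :
    ∫⁻ x in ball y R, σ (ball x r) ≤ volume (ball (0 : 𝔼) r) * σ (ball y (R + r)) := by
  have hs' : MeasurableSet {z : 𝔼 × 𝔼 | dist z.2 z.1 < r} :=
    (isOpen_lt (by fun_prop) (by fun_prop)).measurableSet
  have hs : MeasurableSet {z : 𝔼 × 𝔼 | z.1 ∈ ball y R ∧ dist z.2 z.1 < r} :=
    (measurable_fst measurableSet_ball).inter hs'
  have hm : Measurable ({z : 𝔼 × 𝔼 | z.1 ∈ ball y R ∧ dist z.2 z.1 < r}.indicator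
    fun _ => (1 : ℝ≥0∞)) := measurable_const.indicator hs
  calc ∫⁻ x in ball y R, σ (ball x r)
      = ∫⁻ x, ∫⁻ z, {z : 𝔼 × 𝔼 | z.1 ∈ ball y R ∧ dist z.2 z.1 < r}.indicator
          (fun _ => (1 : ℝ≥0∞)) (x, z) ∂σ := by
        rw [← lintegral_indicator measurableSet_ball]
        refine lintegral_congr fun x => ?_
        by_cases hx : x ∈ ball y R
        · rw [indicator_of_mem hx, ← lintegral_indicator_one measurableSet_ball]
          refine lintegral_congr fun z => ?_
          rw [mem_ball] at hx
          simp only [indicator, mem_ofPred_eq, hx, true_and, mem_ball, Pi.one_apply]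
        · rw [indicator_of_notMem hx]
          refine (lintegral_eq_zero_of_ae_eq_zero (ae_of_all _ fun z => ?_)).symm
          exact indicator_of_notMem (fun h => hx h.1) _
    _ = ∫⁻ z, (∫⁻ x, {z : 𝔼 × 𝔼 | z.1 ∈ ball y R ∧ dist z.2 z.1 < r}.indicator
          (fun _ => (1 : ℝ≥0∞)) (x, z)) ∂σ :=
        lintegral_lintegral_swap (f := fun x z => {z : 𝔼 × 𝔼 | z.1 ∈ ball y R ∧
          dist z.2 z.1 < r}.indicator (fun _ => (1 : ℝ≥0∞)) (x, z)) hm.aemeasurable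
    _ ≤ ∫⁻ z, (ball y (R + r)).indicator (fun _ => volume (ball (0 : 𝔼) r)) z ∂σ := by
        refine lintegral_mono fun z => ?_
        by_cases hz : z ∈ ball y (R + r)
        · rw [indicator_of_mem hz, ← Measure.addHaar_ball_center volume z r,
            ← lintegral_indicator_one measurableSet_ball]
          refine lintegral_mono fun x => ?_
          simp only [indicator, mem_ball, mem_ofPred_eq, Pi.one_apply, dist_comm x z]
          split_ifs with h1 h2 <;> simp_all
        · rw [indicator_of_notMem hz]
          refine le_of_eq (lintegral_eq_zero_of_ae_eq_zero (ae_of_all _ fun x => ?_))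
          refine indicator_of_notMem (fun hx => hz ?_) _
          have := dist_triangle z x y
          simp only [mem_ofPred_eq, mem_ball] at hx ⊢
          linarith
    _ = _ := by rw [lintegral_indicator_const measurableSet_ball]

theorem lintegral_mul_le_lintegral_mul_average {φ ψ ψ' : 𝔼 → ℝ≥0∞} (hφ : Measurable φ)
    (hψ' : Measurable ψ') {R : ℝ} (hR : 0 < R) (h : ∀ x y, dist x y < R → ψ x ≤ ψ' y) :
    ∫⁻ x, φ x * ψ x ≤
      ∫⁻ y, ψ' y * ((volume (ball (0 : 𝔼) R))⁻¹ * ∫⁻ x in ball y R, φ x) := by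
  set V := volume (ball (0 : 𝔼) R)
  have hV0 : V ≠ 0 := (measure_ball_pos _ _ hR).ne'
  have hVt : V ≠ ⊤ := measure_ball_lt_top.ne
  have hs : MeasurableSet {z : 𝔼 × 𝔼 | dist z.1 z.2 < R} :=
    (isOpen_lt (by fun_prop) (by fun_prop)).measurableSet
  have hm : Measurable ({z : 𝔼 × 𝔼 | dist z.1 z.2 < R}.indicator fun z => φ z.1 * ψ' z.2) :=
    Measurable.indicator (by fun_prop) hs
  have hVi : V⁻¹ ≠ ⊤ := ENNReal.inv_ne_top.2 hV0
  calc ∫⁻ x, φ x * ψ x = ∫⁻ x, V⁻¹ * ∫⁻ y in ball x R, φ x * ψ x := by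
        refine lintegral_congr fun x => ?_
        rw [setLIntegral_const, Measure.addHaar_ball_center, mul_comm (_ * _), ← mul_assoc,
          ENNReal.inv_mul_cancel hV0 hVt, one_mul]
    _ = V⁻¹ * ∫⁻ x, ∫⁻ y in ball x R, φ x * ψ x := lintegral_const_mul' _ _ hVi
    _ ≤ V⁻¹ * ∫⁻ x, ∫⁻ y,
          {z : 𝔼 × 𝔼 | dist z.1 z.2 < R}.indicator (fun z => φ z.1 * ψ' z.2) (x, y) := by
        refine mul_le_mul_right (lintegral_mono fun x => ?_) _
        dsimp only
        rw [← lintegral_indicator measurableSet_ball]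
        refine lintegral_mono fun y => ?_
        simp only [indicator, mem_ball, mem_ofPred_eq, dist_comm y x]
        split_ifs with h1
        · gcongr; exact h _ _ h1
        · exact le_rfl
    _ = V⁻¹ * ∫⁻ y, ∫⁻ x,
          {z : 𝔼 × 𝔼 | dist z.1 z.2 < R}.indicator (fun z => φ z.1 * ψ' z.2) (x, y) := by
        rw [lintegral_lintegral_swap (f := fun x y => {z : 𝔼 × 𝔼 | dist z.1 z.2 < R}.indicator
          (fun z => φ z.1 * ψ' z.2) (x, y)) hm.aemeasurable]
    _ = V⁻¹ * ∫⁻ y, ψ' y * ∫⁻ x in ball y R, φ x := by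
        congr 1
        refine lintegral_congr fun y => ?_
        rw [← lintegral_indicator measurableSet_ball, ← lintegral_const_mul _
          (hφ.indicator measurableSet_ball)]
        refine lintegral_congr fun x => ?_
        simp only [indicator, mem_ball, mem_ofPred_eq]
        split_ifs
        · exact mul_comm _ _
        · simp
    _ = ∫⁻ y, V⁻¹ * (ψ' y * ∫⁻ x in ball y R, φ x) := (lintegral_const_mul' _ _ hVi).symm
    _ = _ := lintegral_congr fun y => by ring

/-- The mean density `σ(B(x, 2ᵏ)) / 2^{kd}` at scale `2ᵏ`. -/
noncomputable def dyadicDensity (σ : Measure 𝔼) (d : ℝ) (k : ℤ) (x : 𝔼) : ℝ≥0∞ :=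
  σ (ball x ((2 : ℝ) ^ k)) / ENNReal.ofReal (((2 : ℝ) ^ k) ^ d)

theorem measurable_dyadicDensity (σ : Measure 𝔼) [SFinite σ] (d : ℝ) (k : ℤ) :
    Measurable (dyadicDensity σ d k) :=
  (measurable_measure_ball σ _).div_const _

theorem div_ofReal_zpow_rpow_succ (s : ℝ≥0∞) (d : ℝ) (k : ℤ) :
    s / ENNReal.ofReal (((2 : ℝ) ^ k) ^ d)
      = ENNReal.ofReal (2 ^ d) * (s / ENNReal.ofReal (((2 : ℝ) ^ (k + 1)) ^ d)) := by
  have h2 : (0 : ℝ) < 2 ^ d := by positivity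
  rw [zpow_add_one₀ two_ne_zero, Real.mul_rpow (by positivity) zero_le_two,
    ENNReal.ofReal_mul (by positivity), div_eq_mul_inv, div_eq_mul_inv,
    ENNReal.mul_inv (by simp) (by simp)]
  calc _ = (ENNReal.ofReal (2 ^ d) * (ENNReal.ofReal (2 ^ d))⁻¹) *
        (s * (ENNReal.ofReal ((2 ^ k) ^ d))⁻¹) := by
        rw [ENNReal.mul_inv_cancel (by simpa using h2) (by simp), one_mul]
    _ = _ := by ring

theorem dyadicDensity_le (σ : Measure 𝔼) (d : ℝ) {j k : ℤ} (hjk : j ≤ k) {x y : 𝔼}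
    (hxy : dist x y < (2 : ℝ) ^ j) :
    dyadicDensity σ d k x ≤ ENNReal.ofReal (2 ^ d) * dyadicDensity σ d (k + 1) y := by
  rw [dyadicDensity, dyadicDensity, div_ofReal_zpow_rpow_succ]
  gcongr
  refine ball_subset_ball' ?_
  have : (2 : ℝ) ^ j ≤ 2 ^ k := zpow_le_zpow_right₀ one_le_two hjk
  rw [zpow_add_one₀ two_ne_zero]
  linarith

theorem average_dyadicDensity_le (σ : Measure 𝔼) [SFinite σ] (d : ℝ) (k : ℤ) (l : ℕ) (y : 𝔼) :
    (volume (ball (0 : 𝔼) ((2 : ℝ) ^ (k + l))))⁻¹ *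
        ∫⁻ x in ball y ((2 : ℝ) ^ (k + l)), dyadicDensity σ d k x ≤
      ENNReal.ofReal (2 ^ d) * ENNReal.ofReal (2 ^ (-(n - d))) ^ l *
        dyadicDensity σ d (k + l + 1) y := by
  set v := volume (ball (0 : 𝔼) 1)
  have hv0 : v ≠ 0 := (measure_ball_pos _ _ one_pos).ne'
  have hvt : v ≠ ⊤ := measure_ball_lt_top.ne
  have hV (j : ℤ) : volume (ball (0 : 𝔼) ((2 : ℝ) ^ j)) =
      ENNReal.ofReal (((2 : ℝ) ^ j) ^ n) * v := by
    rw [Measure.addHaar_ball_of_pos _ _ (by positivity), finrank_euclideanSpace_fin]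
  have h1 : ∫⁻ x in ball y ((2 : ℝ) ^ (k + l)), dyadicDensity σ d k x ≤
      (ENNReal.ofReal (((2 : ℝ) ^ k) ^ d))⁻¹ * (ENNReal.ofReal (((2 : ℝ) ^ k) ^ n) * v *
        σ (ball y ((2 : ℝ) ^ (k + l + 1)))) := by
    simp_rw [dyadicDensity, div_eq_mul_inv, mul_comm _ (_⁻¹)]
    rw [lintegral_const_mul _ (measurable_measure_ball σ _)]
    gcongr
    refine (setLIntegral_measure_ball_le σ y _ _).trans ?_
    rw [hV]
    gcongr
    have : (2 : ℝ) ^ k ≤ 2 ^ (k + l) := zpow_le_zpow_right₀ one_le_two (by omega)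
    rw [zpow_add_one₀ two_ne_zero]
    linarith
  refine (mul_le_mul_right h1 _).trans (le_of_eq ?_)
  rw [hV, dyadicDensity, div_eq_mul_inv, ENNReal.mul_inv (Or.inr hvt) (Or.inr hv0),
    ← ENNReal.ofReal_inv_of_pos (by positivity), ← ENNReal.ofReal_inv_of_pos (by positivity),
    ← ENNReal.ofReal_inv_of_pos (by positivity), ← ENNReal.ofReal_pow (by positivity)]
  set s := σ (ball y ((2 : ℝ) ^ (k + l + 1)))
  have key : (((2 : ℝ) ^ (k + l)) ^ n)⁻¹ * ((((2 : ℝ) ^ k) ^ d)⁻¹ * ((2 : ℝ) ^ k) ^ n) =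
      2 ^ d * ((2 : ℝ) ^ (-(n - d))) ^ l * (((2 : ℝ) ^ (k + l + 1)) ^ d)⁻¹ := by
    simp only [← Real.rpow_intCast, ← Real.rpow_natCast, ← Real.rpow_mul zero_le_two,
      ← Real.rpow_neg zero_le_two, ← Real.rpow_add zero_lt_two]
    congr 1
    push_cast
    ring
  calc _ = (v⁻¹ * v) * (ENNReal.ofReal (((2 : ℝ) ^ (k + l)) ^ n)⁻¹ *
        (ENNReal.ofReal (((2 : ℝ) ^ k) ^ d)⁻¹ * ENNReal.ofReal (((2 : ℝ) ^ k) ^ n))) * s := by ring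
    _ = ENNReal.ofReal ((((2 : ℝ) ^ (k + l)) ^ n)⁻¹ *
        ((((2 : ℝ) ^ k) ^ d)⁻¹ * ((2 : ℝ) ^ k) ^ n)) * s := by
      rw [ENNReal.inv_mul_cancel hv0 hvt, one_mul, ← ENNReal.ofReal_mul (by positivity),
        ← ENNReal.ofReal_mul (by positivity)]
    _ = _ := by
      rw [key, ENNReal.ofReal_mul (by positivity), ENNReal.ofReal_mul (by positivity)]
      ring

theorem average_dyadicDensity_rpow_le (σ : Measure 𝔼) [SFinite σ] (d : ℝ) {a : ℝ} (ha0 : 0 < a)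
    (ha1 : a ≤ 1) (k : ℤ) (l : ℕ) (y : 𝔼) :
    (volume (ball (0 : 𝔼) ((2 : ℝ) ^ (k + l))))⁻¹ *
        ∫⁻ x in ball y ((2 : ℝ) ^ (k + l)), dyadicDensity σ d k x ^ a ≤
      ENNReal.ofReal (2 ^ d) ^ a * (ENNReal.ofReal (2 ^ (-(n - d))) ^ a) ^ l *
        dyadicDensity σ d (k + l + 1) y ^ a := by
  have h := ENNReal.rpow_le_rpow (average_dyadicDensity_le σ d k l y) ha0.le
  rw [ENNReal.mul_rpow_of_nonneg _ _ ha0.le, ENNReal.mul_rpow_of_nonneg _ _ ha0.le,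
    ENNReal.mul_rpow_of_nonneg _ _ ha0.le, ← ENNReal.rpow_natCast, ← ENNReal.rpow_mul,
    mul_comm (l : ℝ), ENNReal.rpow_mul, ENNReal.rpow_natCast] at h
  refine le_trans ?_ h
  set V := volume (ball (0 : 𝔼) ((2 : ℝ) ^ (k + l)))
  have hV0 : V ≠ 0 := (measure_ball_pos _ _ (by positivity)).ne'
  have hVt : V ≠ ⊤ := measure_ball_lt_top.ne
  refine (mul_le_mul_right (lintegral_rpow_le_rpow_lintegral_mul
    (measurable_dyadicDensity σ d k) ha0 ha1) _).trans (le_of_eq ?_)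
  rw [Measure.restrict_apply_univ, Measure.addHaar_ball_center, mul_left_comm, mul_comm]
  congr 1
  rw [← ENNReal.rpow_neg_one, ← ENNReal.rpow_add _ _ hV0 hVt, ← ENNReal.rpow_mul]
  congr 1
  ring


theorem sum_range_succ_le_add_iSup (u : ℤ → ℝ≥0∞) {a : ℝ} (ha0 : 0 < a) (L : ℤ) (N : ℕ) :
    ∑ i ∈ Finset.range N, u (L + i + 1) ^ a ≤
      ∑ i ∈ Finset.range N, u (L + i) ^ a + (⨆ k, u k) ^ a := by
  calc ∑ i ∈ Finset.range N, u (L + i + 1) ^ a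
      = ∑ i ∈ Finset.range N, (fun i : ℕ => u (L + i) ^ a) (i + 1) := by
        simp [add_assoc]
    _ ≤ ∑ i ∈ Finset.range (N + 1), (fun i : ℕ => u (L + i) ^ a) i := by
        rw [Finset.sum_range_succ']
        exact le_self_add
    _ ≤ _ := by
        rw [Finset.sum_range_succ]
        gcongr
        exact le_iSup u _

theorem lintegral_dyadicDensity_mul_tail_le (σ : Measure 𝔼) [SFinite σ] (d : ℝ) {a : ℝ}
    (ha0 : 0 < a) (ha1 : a ≤ 1) (m : ℕ) (L : ℤ) (N : ℕ) (k l : ℕ) :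
    ∫⁻ x, dyadicDensity σ d (L + k) x ^ a * (dyadicDensity σ d (L + (k + l : ℕ)) x ^ a *
        (∑ i ∈ Finset.Ico (k + l) N, dyadicDensity σ d (L + i) x ^ a) ^ m) ≤
      (ENNReal.ofReal (2 ^ d) ^ a) ^ (m + 2) * (ENNReal.ofReal (2 ^ (-(n - d))) ^ a) ^ l *
        ∫⁻ x, (⨆ j, dyadicDensity σ d j x) ^ a * (dyadicDensity σ d (L + (k + l : ℕ) + 1) x ^ a *
          (∑ i ∈ Finset.range N, dyadicDensity σ d (L + i) x ^ a +
            (⨆ j, dyadicDensity σ d j x) ^ a) ^ m) := by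
  set D := ENNReal.ofReal (2 ^ d) ^ a
  set θ := ENNReal.ofReal (2 ^ (-(n - d))) ^ a
  have hm (j : ℤ) := measurable_dyadicDensity σ d j
  have hsup : Measurable fun x => ⨆ j, dyadicDensity σ d j x := .iSup hm
  have hF : Measurable fun x => ∑ i ∈ Finset.range N, dyadicDensity σ d (L + i) x ^ a :=
    Finset.measurable_sum _ fun i _ => (hm _).pow_const _
  have hstep {j i : ℤ} (hji : j ≤ i) {x y : 𝔼} (hxy : dist x y < (2 : ℝ) ^ j) :
      dyadicDensity σ d i x ^ a ≤ D * dyadicDensity σ d (i + 1) y ^ a := by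
    rw [← ENNReal.mul_rpow_of_nonneg _ _ ha0.le]
    exact ENNReal.rpow_le_rpow (dyadicDensity_le σ d hji hxy) ha0.le
  have hloc : ∀ x y : 𝔼, dist x y < (2 : ℝ) ^ (L + k + l) →
      dyadicDensity σ d (L + (k + l : ℕ)) x ^ a *
        (∑ i ∈ Finset.Ico (k + l) N, dyadicDensity σ d (L + i) x ^ a) ^ m ≤
      (D * dyadicDensity σ d (L + (k + l : ℕ) + 1) y ^ a) *
        (D * (∑ i ∈ Finset.range N, dyadicDensity σ d (L + i) y ^ a +
            (⨆ j, dyadicDensity σ d j y) ^ a)) ^ m := by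
    intro x y hxy
    gcongr
    · exact hstep (by push_cast; omega) hxy
    · calc ∑ i ∈ Finset.Ico (k + l) N, dyadicDensity σ d (L + i) x ^ a
          ≤ ∑ i ∈ Finset.Ico (k + l) N, D * dyadicDensity σ d (L + i + 1) y ^ a := by
            refine Finset.sum_le_sum fun i hi => hstep ?_ hxy
            have := (Finset.mem_Ico.1 hi).1
            omega
        _ ≤ ∑ i ∈ Finset.range N, D * dyadicDensity σ d (L + i + 1) y ^ a := by
            refine Finset.sum_le_sum_of_subset fun i hi => ?_
            simp only [Finset.mem_Ico, Finset.mem_range] at hi ⊢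
            exact hi.2
        _ ≤ _ := by
            rw [← Finset.mul_sum]
            gcongr
            exact sum_range_succ_le_add_iSup (fun k => dyadicDensity σ d k y) ha0 L N
  refine (lintegral_mul_le_lintegral_mul_average ((hm _).pow_const _) (by fun_prop)
    (by positivity) hloc).trans ?_
  rw [← lintegral_const_mul _ (by fun_prop)]
  refine lintegral_mono fun y => ?_
  have havg := average_dyadicDensity_rpow_le σ d ha0 ha1 (L + k) l y
  have hle : dyadicDensity σ d (L + k + l + 1) y ^ a ≤ (⨆ j, dyadicDensity σ d j y) ^ a := by
    gcongr
    exact le_iSup (fun j => dyadicDensity σ d j y) _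
  refine (mul_le_mul_right (havg.trans (mul_le_mul_right hle _)) _).trans (le_of_eq ?_)
  rw [mul_pow]
  ring

theorem exists_lintegral_sum_dyadicDensity_pow_le_mul (σ : Measure 𝔼) [SFinite σ] {d : ℝ}
    (hd : d < n) {a : ℝ} (ha0 : 0 < a) (ha1 : a ≤ 1) (m : ℕ) :
    ∃ C : ℝ≥0∞, C ≠ ⊤ ∧ 1 ≤ C ∧ ∀ (L : ℤ) (N : ℕ),
      ∫⁻ x, (∑ i ∈ Finset.range N, dyadicDensity σ d (L + i) x ^ a) ^ (m + 2) ≤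
        C * ∫⁻ x, (⨆ j, dyadicDensity σ d j x) ^ a *
          (∑ i ∈ Finset.range N, dyadicDensity σ d (L + i) x ^ a +
            (⨆ j, dyadicDensity σ d j x) ^ a) ^ (m + 1) := by
  set D := ENNReal.ofReal (2 ^ d) ^ a
  set θ := ENNReal.ofReal (2 ^ (-(n - d))) ^ a
  have hD : D ≠ ⊤ := ENNReal.rpow_ne_top_of_nonneg ha0.le ENNReal.ofReal_ne_top
  have hθ1 : θ < 1 := by
    refine ENNReal.rpow_lt_one ?_ ha0
    rw [ENNReal.ofReal_lt_one]
    exact Real.rpow_lt_one_of_one_lt_of_neg one_lt_two (by linarith)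
  have hθi : (1 - θ)⁻¹ ≠ ⊤ := ENNReal.inv_ne_top.2 (tsub_pos_of_lt hθ1).ne'
  have hm (j : ℤ) := measurable_dyadicDensity σ d j
  have hsup : Measurable fun x => ⨆ j, dyadicDensity σ d j x := .iSup hm
  refine ⟨1 + (m + 2) * (m + 1) * (D ^ (m + 2) * (1 - θ)⁻¹), by finiteness, le_self_add,
    fun L N => ?_⟩
  have hF : Measurable fun x => ∑ i ∈ Finset.range N, dyadicDensity σ d (L + i) x ^ a :=
    Finset.measurable_sum _ fun i _ => (hm _).pow_const _
  have hT (j : ℕ) : Measurable fun x =>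
      ∑ i ∈ Finset.Ico j N, dyadicDensity σ d (L + i) x ^ a :=
    Finset.measurable_sum _ fun i _ => (hm _).pow_const _
  set P : 𝔼 → ℝ≥0∞ := fun x => (⨆ j, dyadicDensity σ d j x) ^ a
  set F : 𝔼 → ℝ≥0∞ := fun x => ∑ i ∈ Finset.range N, dyadicDensity σ d (L + i) x ^ a
  have hP : Measurable P := hsup.pow_const _
  set g : ℕ → ℝ≥0∞ := fun j =>
    ∫⁻ x, P x * (dyadicDensity σ d (L + j + 1) x ^ a * (F x + P x) ^ m)
  calc ∫⁻ x, F x ^ (m + 2)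
      ≤ ∫⁻ x, (m + 2) * (m + 1) * ∑ j ∈ Finset.range N, ∑ k ∈ Finset.range (j + 1),
          dyadicDensity σ d (L + k) x ^ a * (dyadicDensity σ d (L + j) x ^ a *
            (∑ i ∈ Finset.Ico j N, dyadicDensity σ d (L + i) x ^ a) ^ m) :=
        lintegral_mono fun x => ENNReal.sum_range_pow_add_two_le
          (fun i : ℕ => dyadicDensity σ d (L + i) x ^ a) N m
    _ = (m + 2) * (m + 1) * ∑ j ∈ Finset.range N, ∑ k ∈ Finset.range (j + 1),
          ∫⁻ x, dyadicDensity σ d (L + k) x ^ a * (dyadicDensity σ d (L + j) x ^ a *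
            (∑ i ∈ Finset.Ico j N, dyadicDensity σ d (L + i) x ^ a) ^ m) := by
        rw [lintegral_const_mul' _ _ (by finiteness), lintegral_finsetSum _ (by fun_prop)]
        congr 1
        exact Finset.sum_congr rfl fun j _ => lintegral_finsetSum _ (by fun_prop)
    _ ≤ (m + 2) * (m + 1) * ∑ j ∈ Finset.range N, ∑ k ∈ Finset.range (j + 1),
          D ^ (m + 2) * θ ^ (j - k) * g j := by
        gcongr with j hj k hk
        have hkj : k + (j - k) = j := by have := Finset.mem_range.1 hk; omega
        have h := lintegral_dyadicDensity_mul_tail_le σ d ha0 ha1 m L N k (j - k)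
        rwa [hkj] at h
    _ ≤ (m + 2) * (m + 1) * ∑ j ∈ Finset.range N, D ^ (m + 2) * (1 - θ)⁻¹ * g j := by
        gcongr with j hj
        rw [← Finset.sum_mul, ← Finset.mul_sum]
        gcongr
        rw [← ENNReal.tsum_geometric, Finset.sum_flip (fun i => θ ^ i)]
        exact ENNReal.sum_le_tsum _
    _ = (m + 2) * (m + 1) * (D ^ (m + 2) * (1 - θ)⁻¹) * ∑ j ∈ Finset.range N, g j := by
        rw [← Finset.mul_sum]
        ring
    _ ≤ (1 + (m + 2) * (m + 1) * (D ^ (m + 2) * (1 - θ)⁻¹)) *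
          ∫⁻ x, P x * (F x + P x) ^ (m + 1) := by
        gcongr
        · exact le_add_self
        rw [← lintegral_finsetSum _ (by fun_prop)]
        refine lintegral_mono fun x => ?_
        rw [← Finset.mul_sum, ← Finset.sum_mul, pow_succ']
        gcongr
        exact sum_range_succ_le_add_iSup (fun k => dyadicDensity σ d k x) ha0 L N

theorem exists_lintegral_sum_dyadicDensity_pow_le (σ : Measure 𝔼) [SFinite σ] {d : ℝ}
    (hd : d < n) {a : ℝ} (ha0 : 0 < a) (ha1 : a ≤ 1) (m : ℕ)
    (hfin : ∫⁻ x, ((⨆ j, dyadicDensity σ d j x) ^ a) ^ (m + 2) ≠ ⊤) :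
    ∃ C : ℝ≥0∞, C ≠ ⊤ ∧ ∀ (L : ℤ) (N : ℕ),
      ∫⁻ x, (∑ i ∈ Finset.range N, dyadicDensity σ d (L + i) x ^ a) ^ (m + 2) ≤
        C * ∫⁻ x, ((⨆ j, dyadicDensity σ d j x) ^ a) ^ (m + 2) := by
  obtain ⟨C, hC, hC1, h⟩ := exists_lintegral_sum_dyadicDensity_pow_le_mul σ hd ha0 ha1 m
  have hsup : Measurable fun x => ⨆ j, dyadicDensity σ d j x :=
    .iSup (measurable_dyadicDensity σ d)
  refine ⟨2 * (C * (C * 2 ^ (m + 2) + 1) ^ (m + 1)), by finiteness, fun L N => ?_⟩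
  refine lintegral_pow_le_of_le_mul_add_pow (hsup.pow_const _) hC hC1 (h L N) ?_
  refine ne_top_of_le_ne_top
    (ENNReal.mul_ne_top (a := (N : ℝ≥0∞) ^ (m + 2)) (by finiteness) hfin) ?_
  rw [← lintegral_const_mul' _ _ (by finiteness)]
  refine lintegral_mono fun x => ?_
  dsimp only
  rw [← mul_pow]
  gcongr
  rw [← nsmul_eq_mul]
  refine (Finset.sum_le_card_nsmul _ _ ((⨆ j, dyadicDensity σ d j x) ^ a) fun i _ => ?_).trans
    (by rw [Finset.card_range])
  gcongr
  exact le_iSup (fun j => dyadicDensity σ d j x) _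

theorem lintegral_tsum_dyadicDensity_pow_ne_top (σ : Measure 𝔼) [SFinite σ] {d : ℝ}
    (hd : d < n) {a : ℝ} (ha0 : 0 < a) (ha1 : a ≤ 1) (m : ℕ)
    (hfin : ∫⁻ x, ((⨆ j, dyadicDensity σ d j x) ^ a) ^ (m + 2) ≠ ⊤) :
    ∫⁻ x, (∑' k : ℤ, dyadicDensity σ d k x ^ a) ^ (m + 2) ≠ ⊤ := by
  obtain ⟨C, hC, h⟩ := exists_lintegral_sum_dyadicDensity_pow_le σ hd ha0 ha1 m hfin
  have hs : Filter.Tendsto (fun M : ℕ =>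
      (Finset.range (2 * M)).image fun i : ℕ => -(M : ℤ) + i) Filter.atTop Filter.atTop := by
    refine Filter.tendsto_atTop_finset_of_monotone (fun M M' hM k hk => ?_) fun k => ?_
    · simp only [Finset.mem_image, Finset.mem_range] at hk ⊢
      obtain ⟨i, hi, rfl⟩ := hk
      exact ⟨i + (M' - M), by omega, by omega⟩
    · refine ⟨k.natAbs + 1, ?_⟩
      simp only [Finset.mem_image, Finset.mem_range]
      exact ⟨(k + (k.natAbs + 1)).toNat, by omega, by omega⟩
  have hlim (x : 𝔼) : Filter.Tendsto (fun M : ℕ =>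
      (∑ i ∈ Finset.range (2 * M), dyadicDensity σ d (-(M : ℤ) + i) x ^ a) ^ (m + 2))
      Filter.atTop (nhds ((∑' k : ℤ, dyadicDensity σ d k x ^ a) ^ (m + 2))) := by
    have := (ENNReal.summable (f := fun k : ℤ => dyadicDensity σ d k x ^ a)).hasSum.comp hs
    refine (ENNReal.Tendsto.pow (n := m + 2) this).congr fun M => ?_
    simp only [Function.comp_apply]
    rw [Finset.sum_image fun i _ j _ hij => by simpa using hij]
  refine ne_top_of_le_ne_top (ENNReal.mul_ne_top hC hfin) ?_
  calc _ = ∫⁻ x, Filter.liminf (fun M : ℕ => (∑ i ∈ Finset.range (2 * M),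
          dyadicDensity σ d (-(M : ℤ) + i) x ^ a) ^ (m + 2)) Filter.atTop :=
        lintegral_congr fun x => (hlim x).liminf_eq.symm
    _ ≤ Filter.liminf (fun M : ℕ => ∫⁻ x, (∑ i ∈ Finset.range (2 * M),
          dyadicDensity σ d (-(M : ℤ) + i) x ^ a) ^ (m + 2)) Filter.atTop :=
        lintegral_liminf_le fun M => (Finset.measurable_sum _ fun i _ =>
          (measurable_dyadicDensity σ d _).pow_const _).pow_const _
    _ ≤ _ := Filter.liminf_le_of_le (by isBoundedDefault) fun b hb => by
        obtain ⟨M, hM⟩ := hb.exists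
        exact hM.trans (h _ _)

theorem half_mul_le_lintegral_div {h : ℝ → ℝ≥0∞} {ρ : ℝ} (hρ : 0 < ρ) {A : ℝ≥0∞}
    (hA : ∀ t ∈ Ioc ρ (2 * ρ), A ≤ h t) :
    2⁻¹ * A ≤ ∫⁻ t in Ioi (0 : ℝ), h t / ENNReal.ofReal t := by
  calc 2⁻¹ * A = ∫⁻ _ in Ioc ρ (2 * ρ), A / ENNReal.ofReal (2 * ρ) := by
        have h0 : ENNReal.ofReal ρ ≠ 0 := by simpa using hρ
        rw [setLIntegral_const, Real.volume_Ioc, show 2 * ρ - ρ = ρ by ring,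
          ENNReal.ofReal_mul zero_le_two, ENNReal.ofReal_ofNat, div_eq_mul_inv,
          ENNReal.mul_inv (by simp) (by simp), ← mul_assoc, mul_assoc,
          ENNReal.inv_mul_cancel h0 (by simp), mul_one, mul_comm]
    _ ≤ ∫⁻ t in Ioc ρ (2 * ρ), h t / ENNReal.ofReal t := by
        refine setLIntegral_mono' measurableSet_Ioc fun t ht => ?_
        gcongr
        · exact hA t ht
        · exact ht.2
    _ ≤ _ := lintegral_mono_set fun t ht => hρ.trans ht.1

theorem setLIntegral_Ioc_div_le {h : ℝ → ℝ≥0∞} {ρ : ℝ} (hρ : 0 < ρ) {A : ℝ≥0∞}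
    (hA : ∀ t ∈ Ioc ρ (2 * ρ), h t ≤ A) :
    ∫⁻ t in Ioc ρ (2 * ρ), h t / ENNReal.ofReal t ≤ A := by
  calc ∫⁻ t in Ioc ρ (2 * ρ), h t / ENNReal.ofReal t
      ≤ ∫⁻ _ in Ioc ρ (2 * ρ), A / ENNReal.ofReal ρ := by
        refine setLIntegral_mono' measurableSet_Ioc fun t ht => ?_
        gcongr
        · exact hA t ht
        · exact ht.1.le
    _ = A := by
        have h0 : ENNReal.ofReal ρ ≠ 0 := by simpa using hρ
        rw [setLIntegral_const, Real.volume_Ioc, show 2 * ρ - ρ = ρ by ring,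
          ENNReal.div_mul_cancel h0 (by simp)]

theorem ENNReal.tsum_rpow_le_rpow_tsum {ι : Type*} (f : ι → ℝ≥0∞) {a b : ℝ} (ha : 0 < a)
    (hab : a ≤ b) : ∑' i, f i ^ b ≤ (∑' i, f i ^ a) ^ (b / a) := by
  have hc : 0 ≤ b / a - 1 := by rw [sub_nonneg, one_le_div ha]; exact hab
  calc ∑' i, f i ^ b = ∑' i, f i ^ a * (f i ^ a) ^ (b / a - 1) := by
        refine tsum_congr fun i => ?_
        rw [← ENNReal.rpow_mul, ← ENNReal.rpow_add_of_nonneg _ _ ha.le (by positivity)]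
        congr 1
        field_simp
        ring
    _ ≤ ∑' i, f i ^ a * (∑' j, f j ^ a) ^ (b / a - 1) := by
        gcongr with i
        exact ENNReal.le_tsum i
    _ = (∑' i, f i ^ a) ^ (1 : ℝ) * (∑' j, f j ^ a) ^ (b / a - 1) := by
        rw [ENNReal.tsum_mul_right, ENNReal.rpow_one]
    _ = _ := by
        rw [← ENNReal.rpow_add_of_nonneg _ _ zero_le_one hc, add_sub_cancel]

theorem embC_mono {α p q : ℝ} (hq : 0 < q) (σ : Measure 𝔼) {E E' : Set 𝔼} (h : E ⊆ E') :
    embC n α p q σ E ≤ embC n α p q σ E' := by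
  refine sInf_le_sInf fun κ hκ ν hν => le_trans ?_ (hκ ν hν)
  exact ENNReal.rpow_le_rpow (lintegral_mono_set h) (by positivity)

theorem le_wolffPot_dirac {α p : ℝ} (hp : 1 < p) (hd : 0 ≤ n - α * p) {x y : 𝔼} {ρ : ℝ}
    (hρ : 0 < ρ) (hy : y ∈ ball x ρ) :
    2⁻¹ * (ENNReal.ofReal ((2 * ρ) ^ (n - α * p)))⁻¹ ^ (1 / (p - 1)) ≤
      wolffPot n α p (Measure.dirac x) y := by
  refine half_mul_le_lintegral_div hρ fun t ht => ?_
  have ht0 : 0 < t := hρ.trans ht.1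
  have hp' : 0 ≤ 1 / (p - 1) := by have := sub_pos.2 hp; positivity
  have hx : x ∈ ball y t := by
    rw [mem_ball, dist_comm]
    exact (mem_ball.1 hy).trans ht.1
  refine ENNReal.rpow_le_rpow ?_ hp'
  rw [Measure.dirac_apply_of_mem hx, one_div]
  gcongr
  exact ht.2

theorem le_embC_ball {α p q : ℝ} (hp : 1 < p) (hq : 0 < q) (hd : 0 ≤ n - α * p)
    (σ : Measure 𝔼) (x : 𝔼) {ρ : ℝ} (hρ : 0 < ρ) :
    2⁻¹ * (ENNReal.ofReal ((2 * ρ) ^ (n - α * p)))⁻¹ ^ (1 / (p - 1)) * σ (ball x ρ) ^ (1 / q) ≤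
      embC n α p q σ (ball x ρ) := by
  refine le_sInf fun κ hκ => ?_
  have h := hκ (Measure.dirac x) inferInstance
  rw [measure_univ, ENNReal.one_rpow, mul_one] at h
  refine le_trans ?_ h
  set A := 2⁻¹ * (ENNReal.ofReal ((2 * ρ) ^ (n - α * p)))⁻¹ ^ (1 / (p - 1))
  calc A * σ (ball x ρ) ^ (1 / q) = (∫⁻ _ in ball x ρ, A ^ q ∂σ) ^ (1 / q) := by
        rw [setLIntegral_const, ENNReal.mul_rpow_of_nonneg _ _ (by positivity),
          ← ENNReal.rpow_mul, mul_one_div_cancel hq.ne', ENNReal.rpow_one]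
    _ ≤ _ := by
        refine ENNReal.rpow_le_rpow ?_ (by positivity)
        refine setLIntegral_mono' measurableSet_ball fun y hy => ?_
        exact ENNReal.rpow_le_rpow (le_wolffPot_dirac hp hd hρ hy) hq.le

theorem exists_dyadicDensity_rpow_le_intK {α p q : ℝ} (hp : 1 < p) (hq : 0 < q)
    (hqp : q < p - 1) (hd : 0 ≤ n - α * p) (σ : Measure 𝔼) :
    ∃ C : ℝ≥0∞, C ≠ ⊤ ∧ ∀ (x : 𝔼) (k : ℤ),
      dyadicDensity σ (n - α * p) k x ^ (1 / (p - 1 - q)) ≤ C * intK n α p q σ x := by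
  have hγ : 0 < p - 1 := sub_pos.2 hp
  have hγq : 0 < p - 1 - q := sub_pos.2 hqp
  set e := q * (p - 1) / (p - 1 - q)
  have he : 0 < e := by positivity
  set c : ℝ≥0∞ := 2⁻¹ * (2⁻¹ ^ e) ^ (1 / (p - 1))
  have hc0 : c ≠ 0 := by
    refine mul_ne_zero (by simp) (ENNReal.rpow_pos (ENNReal.rpow_pos (by simp) (by simp)) ?_).ne'
    exact ENNReal.rpow_ne_top_of_nonneg he.le (by simp)
  have hct : c ≠ ⊤ := by
    refine ENNReal.mul_ne_top (by simp) (ENNReal.rpow_ne_top_of_nonneg (by positivity) ?_)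
    exact ENNReal.rpow_ne_top_of_nonneg he.le (by simp)
  refine ⟨ENNReal.ofReal (2 ^ (n - α * p)) ^ (1 / (p - 1 - q)) * c⁻¹,
    ENNReal.mul_ne_top (ENNReal.rpow_ne_top_of_nonneg (by positivity) (by simp))
      (ENNReal.inv_ne_top.2 hc0), fun x k => ?_⟩
  have hρ : (0 : ℝ) < 2 ^ k := by positivity
  rw [dyadicDensity, div_ofReal_zpow_rpow_succ, ENNReal.mul_rpow_of_nonneg _ _ (by positivity),
    mul_assoc, zpow_add_one₀ two_ne_zero, mul_comm _ (2 : ℝ)]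
  gcongr
  set ρ : ℝ := 2 ^ k
  have h1 := le_embC_ball (α := α) hp hq hd σ x hρ
  have h2 : 2⁻¹ * (embC n α p q σ (ball x ρ) ^ e /
      ENNReal.ofReal ((2 * ρ) ^ (n - α * p))) ^ (1 / (p - 1)) ≤ intK n α p q σ x := by
    refine half_mul_le_lintegral_div hρ fun t ht => ?_
    have ht0 : 0 < t := hρ.trans ht.1
    refine ENNReal.rpow_le_rpow ?_ (by positivity)
    refine ENNReal.div_le_div (ENNReal.rpow_le_rpow (embC_mono hq σ ?_) he.le) ?_
    · exact ball_subset_ball ht.1.le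
    · gcongr
      exact ht.2
  set T := ENNReal.ofReal ((2 * ρ) ^ (n - α * p))
  set S := σ (ball x ρ)
  have h3 : c * (S / T) ^ (1 / (p - 1 - q)) =
      2⁻¹ * ((2⁻¹ * T⁻¹ ^ (1 / (p - 1)) * S ^ (1 / q)) ^ e / T) ^ (1 / (p - 1)) := by
    have hγ' : 0 ≤ 1 / (p - 1) := by positivity
    have hb' : 0 ≤ 1 / (p - 1 - q) := by positivity
    have hT1 : (T⁻¹ ^ (1 / (p - 1))) ^ e * T⁻¹ = T⁻¹ ^ (1 / (p - 1) * e + 1) := by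
      rw [← ENNReal.rpow_mul, ENNReal.rpow_add_of_nonneg _ _ (by positivity) zero_le_one,
        ENNReal.rpow_one]
    calc c * (S / T) ^ (1 / (p - 1 - q))
        = c * (S ^ (1 / (p - 1 - q)) * T⁻¹ ^ (1 / (p - 1 - q))) := by
          rw [div_eq_mul_inv, ENNReal.mul_rpow_of_nonneg _ _ hb']
      _ = 2⁻¹ * (2⁻¹ ^ e * (T⁻¹ ^ (1 / (p - 1) * e + 1) * (S ^ (1 / q)) ^ e)) ^ (1 / (p - 1)) := by
          rw [ENNReal.mul_rpow_of_nonneg _ _ hγ', ENNReal.mul_rpow_of_nonneg _ _ hγ',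
            ← ENNReal.rpow_mul T⁻¹, ← ENNReal.rpow_mul S, ← ENNReal.rpow_mul S,
            show (1 / (p - 1) * e + 1) * (1 / (p - 1)) = 1 / (p - 1 - q) by
              simp only [e]; field_simp; ring,
            show 1 / q * e * (1 / (p - 1)) = 1 / (p - 1 - q) by
              simp only [e]; field_simp]
          simp only [c]
          ring
      _ = _ := by
          rw [← hT1, ENNReal.mul_rpow_of_nonneg _ _ he.le, ENNReal.mul_rpow_of_nonneg _ _ he.le,
            div_eq_mul_inv _ T]
          congr 2
          ring
  rw [← one_mul ((S / T) ^ _), ← ENNReal.inv_mul_cancel hc0 hct, mul_assoc, h3]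
  gcongr
  refine le_trans ?_ h2
  gcongr

theorem wolffPot_le_tsum_dyadicDensity {α p : ℝ} (hp : 1 < p) (hd : 0 ≤ n - α * p)
    (σ : Measure 𝔼) (x : 𝔼) :
    wolffPot n α p σ x ≤ ENNReal.ofReal (2 ^ (n - α * p)) ^ (1 / (p - 1)) *
      ∑' k : ℤ, dyadicDensity σ (n - α * p) k x ^ (1 / (p - 1)) := by
  have hγ : 0 ≤ 1 / (p - 1) := by have := sub_pos.2 hp; positivity
  have hcover : Ioi (0 : ℝ) ⊆ ⋃ k : ℤ, Ioc ((2 : ℝ) ^ k) (2 * 2 ^ k) := fun t ht => by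
    obtain ⟨k, hk⟩ := exists_mem_Ioc_zpow (mem_Ioi.1 ht) one_lt_two
    rw [zpow_add_one₀ two_ne_zero, mul_comm] at hk
    exact mem_iUnion.2 ⟨k, hk⟩
  rw [← (Equiv.addRight (1 : ℤ)).tsum_eq, ← ENNReal.tsum_mul_left]
  refine (lintegral_mono_set hcover).trans ((lintegral_iUnion_le _ _).trans ?_)
  refine ENNReal.tsum_le_tsum fun k => setLIntegral_Ioc_div_le (by positivity) fun t ht => ?_
  have hk : (0 : ℝ) < 2 ^ k := by positivity
  rw [← ENNReal.mul_rpow_of_nonneg _ _ hγ, Equiv.coe_addRight, dyadicDensity,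
    ← div_ofReal_zpow_rpow_succ, zpow_add_one₀ two_ne_zero, mul_comm _ (2 : ℝ)]
  refine ENNReal.rpow_le_rpow (ENNReal.div_le_div (measure_mono (ball_subset_ball ht.2)) ?_) hγ
  gcongr
  exact ht.1.le

end Balls

/-- If `K_{α,p,q}σ ∈ L^r(ℝⁿ)` then `W_{α,p}σ ∈ L^{r(p−1)/(p−1−q)}(ℝⁿ)`. -/
theorem wolff_mem_Lr_of_intK_mem_Lr (n : ℕ) (hn : 1 ≤ n) (α p q r : ℝ)
    (hp : 1 < p) (hq0 : 0 < q) (hqp : q < p - 1)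
    (hα0 : 0 < α) (hαp : α < n / p) (hr : 0 < r)
    (σ : Measure (EuclideanSpace ℝ (Fin n))) (hσloc : IsLocallyFiniteMeasure σ)
    (hK : (∫⁻ x, intK n α p q σ x ^ r) < ⊤) :
    (∫⁻ x, wolffPot n α p σ x ^ (r * (p - 1) / (p - 1 - q))) < ⊤ := by
  have hp0 : 0 < p := zero_lt_one.trans hp
  have hγ : 0 < p - 1 := sub_pos.2 hp
  have hγq : 0 < p - 1 - q := sub_pos.2 hqp
  have hd : 0 ≤ n - α * p := by
    have := (lt_div_iff₀ hp0).1 hαp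
    linarith
  have hdn : n - α * p < n := by
    have := mul_pos hα0 hp0
    linarith
  set d := n - α * p
  set s := r / (p - 1 - q)
  have hs : 0 < s := by positivity
  obtain ⟨m, hm⟩ := exists_nat_ge (max s (s * (p - 1)))
  have hm2 : (0 : ℝ) < m + 2 := by positivity
  set a := s / (m + 2)
  have ha0 : 0 < a := by positivity
  have ha1 : a ≤ 1 := by
    rw [div_le_one hm2]
    linarith [le_max_left s (s * (p - 1))]
  have haγ : a ≤ 1 / (p - 1) := by
    rw [div_le_div_iff₀ hm2 hγ]
    linarith [le_max_right s (s * (p - 1))]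
  have has : a * (m + 2) = s := div_mul_cancel₀ _ hm2.ne'
  obtain ⟨C, hC, hCK⟩ := exists_dyadicDensity_rpow_le_intK hp hq0 hqp hd σ
  have hfin : ∫⁻ x, ((⨆ j, dyadicDensity σ d j x) ^ a) ^ (m + 2) ≠ ⊤ := by
    refine ne_top_of_le_ne_top (ENNReal.mul_ne_top
      (ENNReal.rpow_ne_top_of_nonneg hr.le hC) hK.ne) ?_
    rw [← lintegral_const_mul' _ _ (ENNReal.rpow_ne_top_of_nonneg hr.le hC)]
    refine lintegral_mono fun x => ?_
    dsimp only
    have hsup : (⨆ j, dyadicDensity σ d j x) ≤ (C * intK n α p q σ x) ^ (p - 1 - q) := by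
      refine iSup_le fun j => ?_
      have := ENNReal.rpow_le_rpow (hCK x j) hγq.le
      rwa [← ENNReal.rpow_mul, one_div_mul_cancel hγq.ne', ENNReal.rpow_one] at this
    rw [← ENNReal.rpow_natCast, ← ENNReal.rpow_mul, ← ENNReal.mul_rpow_of_nonneg _ _ hr.le]
    push_cast
    rw [has]
    refine (ENNReal.rpow_le_rpow hsup hs.le).trans (le_of_eq ?_)
    rw [← ENNReal.rpow_mul, mul_div_cancel₀ _ hγq.ne']
  have hfin' := lintegral_tsum_dyadicDensity_pow_ne_top σ hdn ha0 ha1 m hfin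
  have hexp : 0 ≤ r * (p - 1) / (p - 1 - q) := by positivity
  set D := (ENNReal.ofReal (2 ^ d) ^ (1 / (p - 1))) ^ (r * (p - 1) / (p - 1 - q))
  have hD : D ≠ ⊤ := ENNReal.rpow_ne_top_of_nonneg hexp
    (ENNReal.rpow_ne_top_of_nonneg (by positivity) ENNReal.ofReal_ne_top)
  refine lt_of_le_of_lt ?_ (ENNReal.mul_ne_top hD hfin').lt_top
  rw [← lintegral_const_mul' _ _ hD]
  refine lintegral_mono fun x => ?_
  refine (ENNReal.rpow_le_rpow (wolffPot_le_tsum_dyadicDensity hp hd σ x) hexp).trans ?_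
  rw [ENNReal.mul_rpow_of_nonneg _ _ hexp]
  refine mul_le_mul_right ?_ _
  refine (ENNReal.rpow_le_rpow (ENNReal.tsum_rpow_le_rpow_tsum _ ha0 haγ) hexp).trans
    (le_of_eq ?_)
  rw [← ENNReal.rpow_mul, ← ENNReal.rpow_natCast]
  congr 1
  push_cast
  simp only [a, s]
  field_simp
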